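/- arXiv:1212.2522 — 2 statements merged into one kernel-verified Lean document; each statement's English description precedes it below -/
import Mathlib

section
/- Let (B, L) be a Banach SN space with Banach SN dual (B*, L̃), and set Λ := −L̃. Let A be a closed linear L-positive subspace of B such that A⁰ is Λ-positive. Then A is maximally L-positive. -/
open NormedSpace

variable {B : Type*} [NormedAddCommGroup B] [NormedSpace ℝ B]

/-- `L : B → B*` is an SN ("symmetric nonexpansive") map: `‖L‖ ≤ 1` and
`⟨b, Lc⟩ = ⟨c, Lb⟩` for all `b, c ∈ B`. -/
def IsSNMap (L : B →L[ℝ] StrongDual ℝ B) : Prop :=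
  ‖L‖ ≤ 1 ∧ ∀ b c : B, L c b = L b c

/-- The quadratic form `q_L(b) := (1/2)⟨b, Lb⟩` of an SN map. -/
noncomputable def qL (L : B →L[ℝ] StrongDual ℝ B) (b : B) : ℝ :=
  (1 / 2) * L b b

/-- `A ⊆ B` is `L`-positive: `A ≠ ∅` and `q_L(b - c) ≥ 0` for all `b, c ∈ A`. -/
def LPos (L : B →L[ℝ] StrongDual ℝ B) (A : Set B) : Prop :=
  A.Nonempty ∧ ∀ b ∈ A, ∀ c ∈ A, 0 ≤ qL L (b - c)

/-- `A` is maximally `L`-positive: it is `L`-positive and not properly contained in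
any other `L`-positive subset of `B`. -/
def MaxLPos (L : B →L[ℝ] StrongDual ℝ B) (A : Set B) : Prop :=
  LPos L A ∧ ∀ C : Set B, LPos L C → A ⊆ C → C = A

/-- The polar subspace `A⁰ := {b* ∈ B* : ⟨a, b*⟩ = 0 for all a ∈ A}`. -/
def polarSet (A : Set B) : Set (StrongDual ℝ B) :=
  {f | ∀ a ∈ A, f a = 0}

/-- `(B*, L')` is a Banach SN dual of `(B, L)`: `L'` is an SN map on `B*` and
`⟨Lb, L'b*⟩ = ⟨b, b*⟩` for all `b ∈ B`, `b* ∈ B*`. -/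
def IsSNDual (L : B →L[ℝ] StrongDual ℝ B) (L' : StrongDual ℝ B →L[ℝ] StrongDual ℝ (StrongDual ℝ B)) : Prop :=
  IsSNMap L' ∧ ∀ (b : B) (b' : StrongDual ℝ B), L' b' (L b) = b' b

/-- A functional dominated by `K + ‖·‖² / 2` has squared norm at most `2 * K`. -/
lemma norm_sq_le_of_le_add_half_norm_sq {E : Type*} [NormedAddCommGroup E] [NormedSpace ℝ E]
    (f : StrongDual ℝ E) (K : ℝ) (h : ∀ b, f b ≤ K + (1 / 2) * ‖b‖ ^ 2) :
    ‖f‖ ^ 2 ≤ 2 * K := by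
  have hK : 0 ≤ K := by simpa using h 0
  have hf : ‖f‖ ≤ √(2 * K) := by
    refine f.opNorm_le_bound (Real.sqrt_nonneg _) fun b => ?_
    have hquad : ∀ t : ℝ, 0 ≤ (1 / 2 * ‖b‖ ^ 2) * (t * t) + (-f b) * t + K := fun t => by
      have ht := h (t • b)
      rw [map_smul, norm_smul, smul_eq_mul, mul_pow, Real.norm_eq_abs, sq_abs] at ht
      linarith
    have hd := discrim_le_zero hquad
    rw [discrim] at hd
    refine abs_le_of_sq_le_sq (b := √(2 * K) * ‖b‖) ?_ (by positivity)
    rw [mul_pow, Real.sq_sqrt (by positivity)]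
    linarith
  calc ‖f‖ ^ 2 ≤ √(2 * K) ^ 2 := by gcongr
    _ = 2 * K := Real.sq_sqrt (by positivity)

lemma two_mul_qL (L : B →L[ℝ] StrongDual ℝ B) (b : B) : 2 * qL L b = L b b := by
  rw [qL]; ring

lemma IsSNMap.abs_apply_self_le {L : B →L[ℝ] StrongDual ℝ B} (hL : IsSNMap L) (b : B) :
    |L b b| ≤ ‖b‖ ^ 2 := by
  calc |L b b| ≤ ‖L‖ * ‖b‖ * ‖b‖ := L.le_opNorm₂ b b
    _ ≤ 1 * ‖b‖ * ‖b‖ := by gcongr; exact hL.1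
    _ = ‖b‖ ^ 2 := by ring

lemma IsSNMap.qL_sub_smul {L : B →L[ℝ] StrongDual ℝ B} (hL : IsSNMap L) (x d : B) (t : ℝ) :
    qL L (x - t • d) = qL L x - t * L x d + t ^ 2 * qL L d := by
  simp only [qL, map_sub, map_smul, sub_apply,
    smul_apply, smul_eq_mul, hL.2 x d]
  ring

lemma LPos.qL_nonneg {L : B →L[ℝ] StrongDual ℝ B} {A : Submodule ℝ B}
    (hA : LPos L (A : Set B)) {a : B} (ha : a ∈ A) : 0 ≤ qL L a := by
  simpa using hA.2 a ha 0 A.zero_mem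

/-- Fenchel duality for `q_L + ‖·‖² / 2` on a translate of an `L`-positive subspace. -/
lemma exists_dual_of_le_qL_add {L : B →L[ℝ] StrongDual ℝ B} (hL : IsSNMap L)
    {A : Submodule ℝ B} (hA : LPos L (A : Set B)) (c : B) (m : ℝ)
    (hm : ∀ x, c - x ∈ A → m ≤ qL L x + (1 / 2) * ‖x‖ ^ 2) :
    ∃ y : StrongDual ℝ B, ∀ x, c - x ∈ A → m + (1 / 2) * ‖y‖ ^ 2 ≤ qL L x + y x := by
  have hconv : ConvexOn ℝ Set.univ fun b : B => (1 / 2 : ℝ) * ‖b‖ ^ 2 :=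
    ((convexOn_univ_norm.pow (fun _ _ => norm_nonneg _) 2).smul (by norm_num : (0 : ℝ) ≤ 1 / 2))
  have hS : Convex ℝ {p : B × ℝ | (1 / 2) * ‖p.1‖ ^ 2 < p.2} := by
    simpa using hconv.convex_strict_epigraph
  have hSo : IsOpen {p : B × ℝ | (1 / 2) * ‖p.1‖ ^ 2 < p.2} :=
    isOpen_lt (by fun_prop) (by fun_prop)
  have hT : Convex ℝ {p : B × ℝ | c - p.1 ∈ A ∧ p.2 ≤ m - qL L p.1} := by
    rintro ⟨x, s⟩ ⟨hx, hs⟩ ⟨x', s'⟩ ⟨hx', hs'⟩ α β hα hβ hαβ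
    simp only at hx hs hx' hs'
    obtain rfl : α = 1 - β := by linarith
    have hxx : x - x' ∈ A := by simpa using A.sub_mem hx' hx
    have hcomb : (1 - β) • x + β • x' = x - β • (x - x') := by module
    simp only [Set.mem_ofPred_eq, Prod.smul_mk, Prod.mk_add_mk, smul_eq_mul, hcomb]
    constructor
    · have h := A.add_mem hx (A.smul_mem β hxx)
      rwa [sub_add] at h
    · have h1 := hL.qL_sub_smul x (x - x') 1
      rw [one_smul, sub_sub_cancel] at h1
      rw [hL.qL_sub_smul]
      nlinarith [mul_le_mul_of_nonneg_left hs hα, mul_le_mul_of_nonneg_left hs' hβ,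
        mul_nonneg (mul_nonneg hα hβ) (hA.qL_nonneg hxx)]
  have hdisj : Disjoint {p : B × ℝ | (1 / 2) * ‖p.1‖ ^ 2 < p.2}
      {p : B × ℝ | c - p.1 ∈ A ∧ p.2 ≤ m - qL L p.1} := by
    rw [Set.disjoint_left]
    rintro ⟨x, s⟩ h1 ⟨h2, h3⟩
    have := hm x h2
    simp only [Set.mem_ofPred_eq] at h1 h3
    linarith
  obtain ⟨f, u, hfS, hfT⟩ := geometric_hahn_banach_open hS hSo hT hdisj
  have hsplit : ∀ b t, f (b, t) = f (b, 0) + t * f (0, 1) := fun b t => by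
    rw [← smul_eq_mul, ← map_smul, ← map_add]
    simp
  set r := f (0, 1) with hr
  have hr0 : r < 0 := by
    have h1 := hfS (c, |m - qL L c| + (1 / 2) * ‖c‖ ^ 2 + 1) (by
      simp only [Set.mem_ofPred_eq]; linarith [abs_nonneg (m - qL L c)])
    have h2 := hfT (c, m - qL L c) (by simp)
    rw [hsplit] at h1 h2
    by_contra! hr1
    have : m - qL L c ≤ |m - qL L c| + (1 / 2) * ‖c‖ ^ 2 + 1 := by
      linarith [le_abs_self (m - qL L c), sq_nonneg ‖c‖]
    linarith [mul_le_mul_of_nonneg_right this hr1]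
  refine ⟨(-r)⁻¹ • f.comp (ContinuousLinearMap.inl ℝ B ℝ), fun x hx => ?_⟩
  set y : StrongDual ℝ B := (-r)⁻¹ • f.comp (ContinuousLinearMap.inl ℝ B ℝ) with hy
  have hfy : ∀ b, f (b, 0) = (-r) * y b := fun b => by
    simp [hy, hr0.ne]
  have hbound := norm_sq_le_of_le_add_half_norm_sq y (qL L x + y x - m) fun b => by
    refine le_of_forall_pos_le_add fun η hη => ?_
    have h1 := hfS (b, (1 / 2) * ‖b‖ ^ 2 + η) (by simp only [Set.mem_ofPred_eq]; linarith)
    have h2 := hfT (x, m - qL L x) ⟨hx, le_rfl⟩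
    rw [hsplit, hfy] at h1 h2
    refine le_of_mul_le_mul_left ?_ (neg_pos.2 hr0)
    linarith
  linarith

/-- If the polar of an `L`-positive subspace is `Λ`-positive, then `q_L + ‖·‖² / 2` has
nonpositive infimum on each of its translates. -/
lemma nonpos_of_le_qL_add {L : B →L[ℝ] StrongDual ℝ B}
    {L' : StrongDual ℝ B →L[ℝ] StrongDual ℝ (StrongDual ℝ B)}
    (hL : IsSNMap L) (hdual : IsSNDual L L') {A : Submodule ℝ B}
    (hA : LPos L (A : Set B)) (hpolar : ∀ w ∈ polarSet (A : Set B), L' w w ≤ 0) (c : B) (m : ℝ)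
    (hm : ∀ x, c - x ∈ A → m ≤ qL L x + (1 / 2) * ‖x‖ ^ 2)
    (happrox : ∀ ε > 0, ∃ x, c - x ∈ A ∧ qL L x + (1 / 2) * ‖x‖ ^ 2 < m + ε) : m ≤ 0 := by
  obtain ⟨y, hy⟩ := exists_dual_of_le_qL_add hL hA c m hm
  have key : ∀ δ > 0, m ≤ δ * (2 * ‖y‖ + δ) + δ ^ 2 / 2 := fun δ hδ => by
    obtain ⟨x, hxA, hx⟩ := happrox (δ ^ 2 / 2) (by positivity)
    have hyx := hy x hxA
    have hyn : y x ≤ ‖y‖ * ‖x‖ := (le_abs_self _).trans (y.le_opNorm x)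
    have hxy : ‖x‖ ≤ ‖y‖ + δ := by
      have := abs_le_of_sq_le_sq' (a := ‖x‖ - ‖y‖) (b := δ) (by linarith) hδ.le
      linarith [this.2]
    have hnorm := norm_sq_le_of_le_add_half_norm_sq ((L x + y).comp A.subtypeL) (δ ^ 2 / 2)
      fun d => by
        have h1 := hy (x - (1 : ℝ) • (d : B)) (by
          simpa [sub_sub_eq_add_sub, add_sub_right_comm] using A.add_mem hxA d.2)
        rw [hL.qL_sub_smul, one_smul, map_sub] at h1
        have h2 := (le_abs_self _).trans (hL.abs_apply_self_le (d : B))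
        rw [← two_mul_qL] at h2
        have h3 : y x ≤ 1 / 2 * ‖x‖ ^ 2 + 1 / 2 * ‖y‖ ^ 2 := by
          linarith [sq_nonneg (‖x‖ - ‖y‖)]
        simp only [ContinuousLinearMap.comp_apply, add_apply,
          Submodule.subtypeL_apply, ← Submodule.coe_norm] at *
        linarith
    obtain ⟨e, he, hen⟩ := exists_extension_norm_eq A ((L x + y).comp A.subtypeL)
    have heδ : ‖e‖ ≤ δ := by
      rw [hen]
      exact le_of_sq_le_sq (by linarith) hδ.le
    have hw := hpolar (L x + (y - e)) fun a ha => by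
      have := he ⟨a, ha⟩
      simp only [ContinuousLinearMap.comp_apply, add_apply,
          Submodule.subtypeL_apply] at this
      simp only [add_apply, sub_apply]
      linarith
    set z := y - e with hz
    have hexp : L' (L x + z) (L x + z) = L x x + 2 * z x + L' z z := by
      have h1 := hdual.1.2 (L x) z
      have h2 := hdual.2 x z
      have h3 := hdual.2 x (L x)
      simp only [map_add, add_apply]
      linarith
    have hzz := (abs_le.1 (hdual.1.abs_apply_self_le z)).1
    have hzn : ‖z‖ ^ 2 ≤ (‖y‖ + δ) ^ 2 := by
      gcongr
      exact (norm_sub_le y e).trans (by gcongr)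
    have hzx : z x = y x - e x := rfl
    have hex : e x ≤ δ * (‖y‖ + δ) :=
      (le_abs_self _).trans ((e.le_opNorm x).trans (by gcongr))
    rw [hexp, ← two_mul_qL, hzx] at hw
    linarith
  have hlim : Filter.Tendsto (fun δ : ℝ => δ * (2 * ‖y‖ + δ) + δ ^ 2 / 2)
      (nhdsWithin 0 (Set.Ioi 0)) (nhds 0) := by
    have : Continuous fun δ : ℝ => δ * (2 * ‖y‖ + δ) + δ ^ 2 / 2 := by fun_prop
    simpa using (this.tendsto 0).mono_left nhdsWithin_le_nhds
  exact ge_of_tendsto hlim (Filter.eventually_of_mem self_mem_nhdsWithin key)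

set_option maxSynthPendingDepth 3 in
/-- Theorem 5.9(a). Let `A` be a closed linear `L`-positive subspace of `B`
with `A⁰` `Λ`-positive (`Λ := -L'`).  Then `A` is maximally `L`-positive. -/
theorem maxLPos_of_polar_LambdaPos [CompleteSpace B] [Nontrivial B]
    (L : B →L[ℝ] StrongDual ℝ B) (L' : StrongDual ℝ B →L[ℝ] StrongDual ℝ (StrongDual ℝ B))
    (hL : IsSNMap L) (hdual : IsSNDual L L')
    (A : Submodule ℝ B) (hAc : IsClosed (A : Set B)) (hApos : LPos L (A : Set B))
    (hpolar : LPos (-L') (polarSet (A : Set B))) :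
    MaxLPos L (A : Set B) := by
  have hpol : ∀ w ∈ polarSet (A : Set B), L' w w ≤ 0 := fun w hw => by
    have h := hpolar.2 w hw 0 fun _ _ => rfl
    rw [sub_zero, qL, neg_apply, neg_apply] at h
    linarith
  refine ⟨hApos, fun C hC hAC => Set.Subset.antisymm (fun c hc => ?_) hAC⟩
  have hq : ∀ x, c - x ∈ A → 0 ≤ qL L x := fun x hx => by
    simpa using hC.2 c hc (c - x) (hAC hx)
  set S : Set ℝ := (fun x => qL L x + (1 / 2) * ‖x‖ ^ 2) '' {x | c - x ∈ A} with hS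
  have hSne : S.Nonempty := ⟨_, c, by simp, rfl⟩
  have hSbdd : BddBelow S := ⟨0, by
    rintro _ ⟨x, hx, rfl⟩
    have := hq x hx
    positivity⟩
  have happrox : ∀ ε > 0, ∃ x, c - x ∈ A ∧ qL L x + (1 / 2) * ‖x‖ ^ 2 < sInf S + ε := fun ε hε => by
    obtain ⟨_, ⟨x, hx, rfl⟩, hlt⟩ := exists_lt_of_csInf_lt hSne (lt_add_of_pos_right (sInf S) hε)
    exact ⟨x, hx, hlt⟩
  have hm : sInf S ≤ 0 := nonpos_of_le_qL_add hL hdual hApos hpol c (sInf S)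
    (fun x hx => csInf_le hSbdd ⟨x, hx, rfl⟩) happrox
  rw [← hAc.closure_eq, Metric.mem_closure_iff]
  intro ε hε
  obtain ⟨x, hx, hlt⟩ := happrox (ε ^ 2 / 2) (by positivity)
  refine ⟨c - x, hx, ?_⟩
  rw [dist_eq_norm, sub_sub_cancel]
  exact lt_of_pow_lt_pow_left₀ 2 hε.le (by linarith [hq x hx])
end

section
/- Let (B, L) be a Banach SN space with Banach SN dual (B*, L̃), and set Λ := −L̃. Let A be a closed linear L-positive subspace of B such that A⁰ is Λ-positive. Then for every c* ∈ B*, inf_{a ∈ A} q_{L̃}(La − c*) ≤ 0. -/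
open NormedSpace

variable {B : Type*} [NormedAddCommGroup B] [NormedSpace ℝ B]

/-- Expansion of a quadratic form along a sum, for a symmetric map. -/
theorem qL_add {L : B →L[ℝ] StrongDual ℝ B} (hL : IsSNMap L) (b c : B) :
    qL L (b + c) = qL L b + L b c + qL L c := by
  simp only [qL, map_add, add_apply]
  linarith [hL.2 b c]

theorem IsSNMap.apply_le {L : B →L[ℝ] StrongDual ℝ B} (hL : IsSNMap L) (b c : B) :
    |L b c| ≤ ‖b‖ * ‖c‖ := by
  rw [← Real.norm_eq_abs]
  refine (L.le_opNorm₂ b c).trans ?_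
  have h := mul_le_mul_of_nonneg_right hL.1 (mul_nonneg (norm_nonneg b) (norm_nonneg c))
  linarith

theorem IsSNMap.abs_qL_le {L : B →L[ℝ] StrongDual ℝ B} (hL : IsSNMap L) (b : B) :
    |qL L b| ≤ ‖b‖ ^ 2 / 2 := by
  rw [qL, abs_mul, abs_of_pos (by norm_num : (0 : ℝ) < 1 / 2)]
  linarith [hL.apply_le b b]

theorem qL_dual_map_sub {L : B →L[ℝ] StrongDual ℝ B}
    {L' : StrongDual ℝ B →L[ℝ] StrongDual ℝ (StrongDual ℝ B)} (hdual : IsSNDual L L')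
    (a : B) (c' : StrongDual ℝ B) :
    qL L' (L a - c') = qL L a - c' a + qL L' c' := by
  have h1 := hdual.2 a (L a)
  have h2 := hdual.2 a c'
  have h3 := hdual.1.2 (L a) c'
  simp only [qL, map_sub, sub_apply]
  linarith

set_option maxSynthPendingDepth 3 in
/-- If `A⁰` is `Λ`-positive and `‖g‖ ≤ ε` on `A`, then `q_{L'}(g) ≤ ε ‖g‖ + ε² / 2`. -/
theorem qL_dual_le_of_restrict_le
    {L' : StrongDual ℝ B →L[ℝ] StrongDual ℝ (StrongDual ℝ B)} (hL' : IsSNMap L')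
    {A : Submodule ℝ B} (hpolar : LPos (-L') (polarSet (A : Set B)))
    {g : StrongDual ℝ B} {ε : ℝ} (hε : 0 ≤ ε) (hg : ∀ x ∈ A, g x ≤ ε * ‖x‖) :
    qL L' g ≤ ε * ‖g‖ + ε ^ 2 / 2 := by
  obtain ⟨e, he, hnorm⟩ := exists_extension_norm_eq A (g.comp A.subtypeL)
  have heε : ‖e‖ ≤ ε := by
    rw [hnorm]
    refine ContinuousLinearMap.opNorm_le_bound _ hε fun x => abs_le.2 ⟨?_, hg x x.2⟩
    have h := hg (-x) (A.neg_mem x.2)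
    rw [map_neg, norm_neg] at h
    change -(ε * ‖(x : B)‖) ≤ g x
    linarith
  have hf : g - e ∈ polarSet (A : Set B) := fun a ha => by
    have h := he ⟨a, ha⟩
    change e a = g a at h
    rw [sub_apply, h, sub_self]
  have hpos := hpolar.2 _ hf 0 fun a _ => rfl
  have hq : qL L' (g - e) ≤ 0 := by
    rw [sub_zero] at hpos
    simp only [qL, neg_apply] at hpos ⊢
    linarith
  have h1 := qL_add hL' (g - e) e
  have h2 : L' (g - e) e = L' g e - 2 * qL L' e := by
    simp only [qL, map_sub, sub_apply]
    ring
  rw [sub_add_cancel, h2] at h1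
  have h3 := (abs_le.1 (hL'.abs_qL_le e)).1
  have h4 := (abs_le.1 (hL'.apply_le g e)).2
  have h5 : ‖g‖ * ‖e‖ ≤ ‖g‖ * ε := by gcongr
  have h6 : ‖e‖ ^ 2 ≤ ε ^ 2 := by gcongr
  linarith

/-- A regularized almost-minimizer: a quadratic functional bounded below on a subspace has points
at which the gradient is small, even after multiplication by the norm of the point. -/
theorem exists_small_gradient {L : B →L[ℝ] StrongDual ℝ B} (hL : IsSNMap L)
    (A : Submodule ℝ B) (c' : StrongDual ℝ B) {m : ℝ} (hm : ∀ a ∈ A, m ≤ qL L a - c' a)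
    {θ : ℝ} (hθ : 0 < θ) (hθ1 : θ ≤ 1) (happrox : ∃ a ∈ A, qL L a - c' a < m + θ ^ 2) :
    ∃ a ∈ A, ∃ ε, 0 ≤ ε ∧ ε ≤ 5 * θ ∧ ε * ‖a‖ ≤ 12 * θ ^ 2 ∧
      ∀ x ∈ A, (L a - c') x ≤ ε * ‖x‖ := by
  obtain ⟨a₀, ha₀, hlt⟩ := happrox
  have hn₀ := norm_nonneg a₀
  obtain ⟨μ, hμ, hμ1, hμa⟩ : ∃ μ : ℝ, 0 < μ ∧ μ ≤ 1 ∧ μ * ‖a₀‖ ≤ θ := by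
    refine ⟨θ / (‖a₀‖ + 1), by positivity, ?_, ?_⟩
    · rw [div_le_one (by positivity)]
      linarith
    · rw [div_mul_eq_mul_div, div_le_iff₀ (by positivity)]
      nlinarith
  have hμa2 : μ ^ 2 * ‖a₀‖ ^ 2 ≤ θ ^ 2 := by
    rw [← mul_pow]
    gcongr
  let h : B → ℝ := fun a => qL L a - c' a + μ ^ 2 / 2 * ‖a‖ ^ 2
  have hbdd : BddBelow (h '' A) := by
    refine ⟨m, ?_⟩
    rintro _ ⟨a, ha, rfl⟩
    have := hm a ha
    have : 0 ≤ μ ^ 2 / 2 * ‖a‖ ^ 2 := by positivity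
    change m ≤ qL L a - c' a + μ ^ 2 / 2 * ‖a‖ ^ 2
    linarith
  have hδ : 0 < (μ * θ) ^ 2 := by positivity
  obtain ⟨_, ⟨a, ha, rfl⟩, hamin⟩ :=
    exists_lt_of_csInf_lt (Set.image_nonempty.2 ⟨a₀, ha₀⟩)
      (lt_add_of_pos_right (sInf (h '' A)) hδ)
  have hmin : ∀ x ∈ A, h a ≤ h x + (μ * θ) ^ 2 := fun x hx => by
    have := csInf_le hbdd ⟨x, hx, rfl⟩
    linarith
  have hr := norm_nonneg a
  have hμr2 : (μ * ‖a‖) ^ 2 ≤ 6 * θ ^ 2 := by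
    have h1 := hmin a₀ ha₀
    have h2 := hm a ha
    have h3 : (μ * θ) ^ 2 ≤ θ ^ 2 := by
      gcongr
      nlinarith
    simp only [h] at h1
    nlinarith
  have hμr : μ * ‖a‖ ≤ 3 * θ := by
    refine le_of_sq_le_sq ?_ (by positivity)
    nlinarith
  refine ⟨a, ha, μ ^ 2 * ‖a‖ + 2 * (μ * θ), by positivity, ?_, ?_, ?_⟩
  · have h1 : μ * (μ * ‖a‖) ≤ 1 * (3 * θ) := by gcongr
    have h2 : μ * θ ≤ 1 * θ := by gcongr
    nlinarith
  · nlinarith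
  · intro x hx
    rcases eq_or_ne x 0 with rfl | hx0
    · simp
    have hxn : 0 < ‖x‖ := norm_pos_iff.2 hx0
    set s := μ * θ with hs
    have hspos : 0 < s := by positivity
    have hst : 0 < s / ‖x‖ := by positivity
    set y : B := -((s / ‖x‖) • x) with hy
    have hyA : y ∈ A := A.neg_mem (A.smul_mem _ hx)
    have hyn : ‖y‖ = s := by
      rw [hy, norm_neg, norm_smul, Real.norm_of_nonneg hst.le, div_mul_cancel₀ _ hxn.ne']
    have h1 := hmin (a + y) (A.add_mem ha hyA)
    simp only [h, qL_add hL, map_add] at h1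
    have h2 := (abs_le.1 (hL.abs_qL_le y)).2
    have h3 : ‖a + y‖ ^ 2 ≤ (‖a‖ + s) ^ 2 := by
      have := norm_add_le a y
      rw [hyn] at this
      gcongr
    have h4 : μ ^ 2 / 2 * ‖a + y‖ ^ 2 ≤ μ ^ 2 / 2 * (‖a‖ + s) ^ 2 := by gcongr
    have h5 : μ ^ 2 * s ^ 2 ≤ 1 * s ^ 2 := by
      gcongr
      nlinarith
    rw [hyn] at h2
    have h6 : (L a - c') y = -((s / ‖x‖) * (L a - c') x) := by
      rw [hy, map_neg, map_smul, smul_eq_mul]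
    have h7 : (s / ‖x‖) * (L a - c') x ≤ s * (μ ^ 2 * ‖a‖ + 2 * s) := by
      rw [sub_apply] at h6
      nlinarith
    rw [div_mul_eq_mul_div, div_le_iff₀ hxn, mul_assoc s (_ + _)] at h7
    exact le_of_mul_le_mul_left h7 hspos

set_option maxSynthPendingDepth 3 in
/-- Theorem 5.9(c). Let `A` be a closed linear `L`-positive subspace of `B`
with `A⁰` `Λ`-positive (`Λ := -L'`).  Then for all `c* ∈ B*`,
`inf_{a ∈ A} q_{L'}(La - c*) ≤ 0`. -/
theorem inf_qDual_nonpos_of_polar_LambdaPos [CompleteSpace B] [Nontrivial B]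
    (L : B →L[ℝ] StrongDual ℝ B) (L' : StrongDual ℝ B →L[ℝ] StrongDual ℝ (StrongDual ℝ B))
    (hL : IsSNMap L) (hdual : IsSNDual L L')
    (A : Submodule ℝ B) (hAc : IsClosed (A : Set B)) (hApos : LPos L (A : Set B))
    (hpolar : LPos (-L') (polarSet (A : Set B)))
    (c' : StrongDual ℝ B) :
    sInf ((fun a => qL L' (L a - c')) '' (A : Set B)) ≤ 0 := by
  by_cases hbdd : BddBelow ((fun a => qL L' (L a - c')) '' (A : Set B))
  swap
  · rw [Real.sInf_of_not_bddBelow hbdd]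
  set S := sInf ((fun a => qL L' (L a - c')) '' (A : Set B)) with hS
  have hle : ∀ a ∈ A, S ≤ qL L' (L a - c') := fun a ha => csInf_le hbdd ⟨a, ha, rfl⟩
  have key : ∀ θ : ℝ, 0 < θ → θ ≤ 1 → S ≤ θ * (25 + 5 * ‖c'‖) := by
    intro θ hθ hθ1
    have hc := norm_nonneg c'
    obtain ⟨a, ha, ε, hε, hεθ, hεa, hgrad⟩ :=
      exists_small_gradient hL A c' (m := S - qL L' c')
        (fun a ha => by linarith [hle a ha, qL_dual_map_sub hdual a c']) hθ hθ1 (by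
          obtain ⟨_, ⟨a, ha, rfl⟩, hlt⟩ :=
            exists_lt_of_csInf_lt (Set.image_nonempty.2 ⟨0, A.zero_mem⟩)
              (lt_add_of_pos_right S (pow_pos hθ 2))
          exact ⟨a, ha, by linarith [hlt, qL_dual_map_sub hdual a c']⟩)
    have h1 := qL_dual_le_of_restrict_le hdual.1 hpolar hε hgrad
    have h2 : ‖L a - c'‖ ≤ ‖a‖ + ‖c'‖ := by
      refine (norm_sub_le _ _).trans ?_
      have := L.le_of_opNorm_le hL.1 a
      linarith
    have h3 : ε * ‖L a - c'‖ ≤ ε * (‖a‖ + ‖c'‖) := by gcongr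
    have h4 : ε * ‖c'‖ ≤ 5 * θ * ‖c'‖ := by gcongr
    have h5 : ε ^ 2 ≤ (5 * θ) ^ 2 := by gcongr
    have h6 := hle a ha
    nlinarith
  by_contra! hpos
  have hK : 0 < 25 + 5 * ‖c'‖ := by positivity
  have h1 := key (min 1 (S / (2 * (25 + 5 * ‖c'‖)))) (by positivity) (min_le_left _ _)
  have h2 : min 1 (S / (2 * (25 + 5 * ‖c'‖))) * (25 + 5 * ‖c'‖) ≤
      S / (2 * (25 + 5 * ‖c'‖)) * (25 + 5 * ‖c'‖) := by
    gcongr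
    exact min_le_right _ _
  have h3 : S / (2 * (25 + 5 * ‖c'‖)) * (25 + 5 * ‖c'‖) = S / 2 := by field_simp
  linarith
end
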